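/- Let G be a connected simple graph on n vertices and let X = (x₁, …, x_n)ᵀ be the Perron vector of G (a positive eigenvector of A(G) for the eigenvalue ρ(G)). Let S₁, S₂, T be three mutually disjoint nonempty subsets of V(G) with e(T, S₁) = 0 and e(T, S₂) = |T||S₂|, and let G′ = G + {ij : i ∈ S₁, j ∈ T} − {ij : i ∈ S₂, j ∈ T}. If Σ_{i∈S₁} x_i ≥ Σ_{i∈S₂} x_i, then ρ(G′) > ρ(G). -/

import Mathlib

open scoped Classical in
/-- The spectral radius of a finite simple graph: the largest eigenvalue (here: the
supremum of the real spectrum) of its adjacency matrix. -/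
noncomputable def specRad {V : Type*} [Fintype V] (G : SimpleGraph V) : ℝ :=
  sSup (spectrum ℝ (G.adjMatrix ℝ))

open scoped Classical in
/-- The spectral radius bounds the adjacency matrix from above in the Loewner order. -/
lemma posSemidef_specRad_smul_one_sub_adjMatrix {V : Type*} [Fintype V] (G : SimpleGraph V) :
    (specRad G • (1 : Matrix V V ℝ) - G.adjMatrix ℝ).PosSemidef := by
  have hA : (G.adjMatrix ℝ).IsHermitian := G.isSymm_adjMatrix
  rw [Matrix.posSemidef_iff_isHermitian_and_spectrum_nonneg]
  refine ⟨Matrix.IsHermitian.sub (by simp [Matrix.IsHermitian]) hA, fun μ hμ => ?_⟩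
  rw [← Algebra.algebraMap_eq_smul_one, ← spectrum.singleton_sub_eq] at hμ
  obtain ⟨a, rfl, b, hb, rfl⟩ := hμ
  exact sub_nonneg.2 (le_csSup (Matrix.finite_real_spectrum).bddAbove hb)

/-- Effect on a vector of switching the neighbourhood of `T` from `S₂` to `S₁`. -/
lemma adjMatrix_mulVec_switch {V : Type*} [Fintype V] [DecidableEq V] {G G' : SimpleGraph V}
    [DecidableRel G.Adj] [DecidableRel G'.Adj] (x : V → ℝ)
    {S₁ S₂ T : Finset V}
    (h12 : Disjoint S₁ S₂) (h1T : Disjoint S₁ T) (h2T : Disjoint S₂ T)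
    (hTS₁ : ∀ i ∈ S₁, ∀ j ∈ T, ¬ G.Adj i j)
    (hTS₂ : ∀ i ∈ S₂, ∀ j ∈ T, G.Adj i j)
    (hG' : ∀ u v, G'.Adj u v ↔
      ((G.Adj u v ∨ (u ∈ S₁ ∧ v ∈ T) ∨ (v ∈ S₁ ∧ u ∈ T)) ∧
        ¬ ((u ∈ S₂ ∧ v ∈ T) ∨ (v ∈ S₂ ∧ u ∈ T)))) (v : V) :
    (G'.adjMatrix ℝ).mulVec x v = (G.adjMatrix ℝ).mulVec x v
      + (if v ∈ T then ∑ i ∈ S₁, x i - ∑ i ∈ S₂, x i else 0)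
      + (if v ∈ S₁ then ∑ j ∈ T, x j else 0) - (if v ∈ S₂ then ∑ j ∈ T, x j else 0) := by
  rw [Finset.disjoint_left] at h12 h1T h2T
  have entry : ∀ w, G'.adjMatrix ℝ v w * x w = G.adjMatrix ℝ v w * x w
      + (if v ∈ T then (if w ∈ S₁ then x w else 0) - (if w ∈ S₂ then x w else 0) else 0)
      + (if v ∈ S₁ then (if w ∈ T then x w else 0) else 0)
      - (if v ∈ S₂ then (if w ∈ T then x w else 0) else 0) := by
    intro w
    have := hG' v w
    have := G.adj_comm v w
    have := h12 (a := v); have := h12 (a := w)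
    have := h1T (a := v); have := h1T (a := w)
    have := h2T (a := v); have := h2T (a := w)
    have := hTS₁ v; have := hTS₁ w; have := hTS₂ v; have := hTS₂ w
    simp only [SimpleGraph.adjMatrix_apply]
    grind
  simp only [Matrix.mulVec, dotProduct, entry, Finset.sum_add_distrib, Finset.sum_sub_distrib]
  split_ifs <;> simp [Finset.sum_ite_mem]

/-- Let `G` be a connected simple graph with Perron vector `x` (a
positive eigenvector of the adjacency matrix for the eigenvalue `ρ(G)`). Let `S₁, S₂, T`
be three mutually disjoint nonempty vertex subsets with `e(T, S₁) = 0` and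
`e(T, S₂) = |T|·|S₂|` (no edges between `T` and `S₁`, all edges between `T` and `S₂`), and
let `G' = G + {ij : i ∈ S₁, j ∈ T} - {ij : i ∈ S₂, j ∈ T}`. If `∑_{i ∈ S₁} xᵢ ≥ ∑_{i ∈ S₂} xᵢ`,
then `ρ(G') > ρ(G)`. -/
theorem statement12 {V : Type*} [Fintype V] (G G' : SimpleGraph V) [DecidableRel G.Adj]
    (hG : G.Connected)
    (x : V → ℝ) (hxpos : ∀ v, 0 < x v)
    (heig : (G.adjMatrix ℝ).mulVec x = specRad G • x)
    (S₁ S₂ T : Finset V) (hS₁ : S₁.Nonempty) (hS₂ : S₂.Nonempty) (hT : T.Nonempty)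
    (h12 : Disjoint S₁ S₂) (h1T : Disjoint S₁ T) (h2T : Disjoint S₂ T)
    (hTS₁ : ∀ i ∈ S₁, ∀ j ∈ T, ¬ G.Adj i j)
    (hTS₂ : ∀ i ∈ S₂, ∀ j ∈ T, G.Adj i j)
    (hG' : ∀ u v, G'.Adj u v ↔
      ((G.Adj u v ∨ (u ∈ S₁ ∧ v ∈ T) ∨ (v ∈ S₁ ∧ u ∈ T)) ∧
        ¬ ((u ∈ S₂ ∧ v ∈ T) ∨ (v ∈ S₂ ∧ u ∈ T))))
    (hsum : ∑ i ∈ S₂, x i ≤ ∑ i ∈ S₁, x i) :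
    specRad G < specRad G' := by
  classical
  have hsw := adjMatrix_mulVec_switch x h12 h1T h2T hTS₁ hTS₂ hG'
  have hps := posSemidef_specRad_smul_one_sub_adjMatrix G'
  have hTpos : 0 < ∑ j ∈ T, x j := Finset.sum_pos (fun j _ => hxpos j) hT
  have hxx : 0 < ∑ v, x v * x v :=
    Finset.sum_pos (fun v _ => mul_pos (hxpos v) (hxpos v)) ⟨_, Finset.mem_univ hT.choose⟩
  have hmul : ∀ v, ((specRad G' • (1 : Matrix V V ℝ) - G'.adjMatrix ℝ).mulVec x) v =
      (specRad G' - specRad G) * x v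
      - (if v ∈ T then ∑ i ∈ S₁, x i - ∑ i ∈ S₂, x i else 0)
      - (if v ∈ S₁ then ∑ j ∈ T, x j else 0) + (if v ∈ S₂ then ∑ j ∈ T, x j else 0) := by
    intro v
    rw [Matrix.sub_mulVec, Matrix.smul_mulVec, Matrix.one_mulVec, Pi.sub_apply, hsw v, heig]
    simp only [Pi.smul_apply, smul_eq_mul]
    ring
  have hquad : dotProduct (star x)
      ((specRad G' • (1 : Matrix V V ℝ) - G'.adjMatrix ℝ).mulVec x) =
      (specRad G' - specRad G) * ∑ v, x v * x v
        - 2 * ((∑ j ∈ T, x j) * (∑ i ∈ S₁, x i - ∑ i ∈ S₂, x i)) := by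
    simp only [dotProduct, hmul, star_trivial, mul_add, mul_sub, mul_ite, mul_zero,
      Finset.sum_add_distrib, Finset.sum_sub_distrib, Finset.sum_ite_mem, Finset.univ_inter,
      Finset.mul_sum, mul_left_comm]
    simp only [← Finset.mul_sum, ← Finset.sum_mul]
    ring
  have hnonneg := hps.dotProduct_mulVec_nonneg x
  have hgain : 0 ≤ (∑ j ∈ T, x j) * (∑ i ∈ S₁, x i - ∑ i ∈ S₂, x i) :=
    mul_nonneg hTpos.le (sub_nonneg.2 hsum)
  by_contra! hle
  have hloss : (specRad G' - specRad G) * ∑ v, x v * x v ≤ 0 :=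
    mul_nonpos_of_nonpos_of_nonneg (sub_nonpos.2 hle) hxx.le
  have hker := (hps.dotProduct_mulVec_zero_iff x).1 (by linarith)
  obtain ⟨i, hi⟩ := hS₁
  have h := hmul i
  rw [hker] at h
  simp only [Pi.zero_apply, hi, Finset.disjoint_left.1 h1T hi, Finset.disjoint_left.1 h12 hi,
    if_true, if_false] at h
  nlinarith [hxpos i, mul_nonneg (sub_nonneg.2 hle) (hxpos i).le]
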